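/- arXiv:2306.01086 — 3 statements merged into one kernel-verified Lean document; each statement's English description precedes it below -/
import Mathlib

section
/- (Proposition 1.) Define the error term ε := Y − Σ_{k=1}^K { μ_k^{(0)}(X) + A·τ_k(X) } · p(k|X). Under Assumption 1 (consistency), Assumption 2 (mean unconfoundedness within study), and the hypothesis that study membership carries no information about treatment given covariates, i.e. E[1{S=k} | σ(A,X)] = p(k|X) a.s. for every k = 1,…,K, it holds that E[ε | σ(A,X)] = 0 almost surely. -/
open MeasureTheory


/-- A variable supported on `{A = c}` whose conditional mean given `(X, S)` vanishes has
vanishing conditional mean given `(A, X)`. -/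
lemma condExp_AX_zero_of_support
    {Ω : Type*} [MeasurableSpace Ω] (μ : Measure Ω) [IsProbabilityMeasure μ]
    {𝒳 𝒮 : Type*} [MeasurableSpace 𝒳] [MeasurableSpace 𝒮]
    (X : Ω → 𝒳) (S : Ω → 𝒮) (A : Ω → ℝ) (U : Ω → ℝ) (c : ℝ)
    (hX : Measurable X) (hS : Measurable S) (hA : Measurable A)
    (hU : Integrable U μ) (hc : ∀ ω, A ω ≠ c → U ω = 0)
    (h0 : μ[U | MeasurableSpace.comap (fun ω => (X ω, S ω)) inferInstance] =ᵐ[μ] 0) :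
    μ[U | MeasurableSpace.comap (fun ω => (A ω, X ω)) inferInstance] =ᵐ[μ] 0 := by
  have hm : MeasurableSpace.comap (fun ω => (A ω, X ω)) inferInstance ≤ ‹MeasurableSpace Ω› :=
    (hA.prodMk hX).comap_le
  have hn : MeasurableSpace.comap (fun ω => (X ω, S ω)) inferInstance ≤ ‹MeasurableSpace Ω› :=
    (hX.prodMk hS).comap_le
  symm
  refine ae_eq_condExp_of_forall_setIntegral_eq hm hU ?_ ?_ ?_
  · intro s _ _
    exact integrableOn_zero
  · rintro s ⟨B, hB, rfl⟩ _
    have hB1 : MeasurableSet ((fun x : 𝒳 => (c, x)) ⁻¹' B) := measurable_prodMk_left hB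
    have hs : MeasurableSet[MeasurableSpace.comap (fun ω => (X ω, S ω)) inferInstance]
        (X ⁻¹' ((fun x : 𝒳 => (c, x)) ⁻¹' B)) :=
      ⟨Prod.fst ⁻¹' ((fun x : 𝒳 => (c, x)) ⁻¹' B), measurable_fst hB1, rfl⟩
    have h1 : ∫ ω in (fun ω => (A ω, X ω)) ⁻¹' B, U ω ∂μ
        = ∫ ω in X ⁻¹' ((fun x : 𝒳 => (c, x)) ⁻¹' B), U ω ∂μ := by
      rw [← integral_indicator ((hA.prodMk hX) hB), ← integral_indicator (hX hB1)]
      congr 1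
      ext ω
      by_cases h : A ω = c
      · have hiff : ω ∈ (fun ω => (A ω, X ω)) ⁻¹' B ↔
            ω ∈ X ⁻¹' ((fun x : 𝒳 => (c, x)) ⁻¹' B) := by
          rw [← h]
          exact Iff.rfl
        by_cases hω : ω ∈ X ⁻¹' ((fun x : 𝒳 => (c, x)) ⁻¹' B)
        · rw [Set.indicator_of_mem hω, Set.indicator_of_mem (hiff.2 hω)]
        · rw [Set.indicator_of_notMem hω, Set.indicator_of_notMem (fun h' => hω (hiff.1 h'))]
      · simp [Set.indicator, hc ω h]
    rw [h1, ← setIntegral_condExp hn hU hs]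
    have h2 : ∫ ω in X ⁻¹' ((fun x : 𝒳 => (c, x)) ⁻¹' B),
        (μ[U | MeasurableSpace.comap (fun ω => (X ω, S ω)) inferInstance]) ω ∂μ
        = ∫ ω in X ⁻¹' ((fun x : 𝒳 => (c, x)) ⁻¹' B), (0 : Ω → ℝ) ω ∂μ :=
      integral_congr_ae (ae_restrict_of_ae h0)
    rw [h2]
    simp
  · exact aestronglyMeasurable_zero

/-- Within-study unconfoundedness kills the weighted residual. -/
lemma condExp_weighted_residual_zero
    {Ω : Type*} {m0 : MeasurableSpace Ω} (μ : Measure Ω) [IsProbabilityMeasure μ]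
    (n : MeasurableSpace Ω) (W Z M : Ω → ℝ)
    (hM : StronglyMeasurable[n] M)
    (hW : Integrable W μ) (hWZ : Integrable (fun ω => W ω * Z ω) μ)
    (hWM : Integrable (fun ω => W ω * M ω) μ)
    (hZM : μ[Z | n] =ᵐ[μ] M)
    (hu : μ[(fun ω => W ω * Z ω) | n] =ᵐ[μ] fun ω => (μ[W | n]) ω * (μ[Z | n]) ω) :
    μ[(fun ω => W ω * (Z ω - M ω)) | n] =ᵐ[μ] 0 := by
  have e : (fun ω => W ω * (Z ω - M ω)) = (fun ω => W ω * Z ω) - (W * M) := by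
    ext ω
    simp [mul_sub]
  rw [e]
  have h1 := condExp_sub hWZ hWM n
  have h2 : μ[W * M | n] =ᵐ[μ] μ[W | n] * M :=
    condExp_mul_of_stronglyMeasurable_right hM hWM hW
  refine h1.trans ?_
  filter_upwards [h2, hu, hZM] with ω a b c
  have a' : (μ[fun ω => W ω * M ω | n]) ω = (μ[W | n]) ω * M ω := a
  simp only [Pi.sub_apply, Pi.zero_apply]
  rw [a', b, c, sub_self]

/-- Proposition 1. Define
`ε := Y − ∑_{k=1}^K { μ_k^{(0)}(X) + A·τ_k(X) } · p(k|X)`. Under consistency, mean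
unconfoundedness within study, and `E[1{S=k} | σ(A,X)] = p(k|X)` a.s. for every `k`, it
holds that `E[ε | σ(A,X)] = 0` almost surely. -/
theorem multi_study_error_term_conditional_mean_zero
    {Ω : Type*} [MeasurableSpace Ω] (μ : Measure Ω) [IsProbabilityMeasure μ]
    {𝒳 : Type*} [MeasurableSpace 𝒳]
    (K : ℕ) (X : Ω → 𝒳) (S : Ω → Fin K) (A : Ω → ℝ) (Y Y0 Y1 : Ω → ℝ)
    (hX : Measurable X) (hS : Measurable S) (hA : Measurable A)
    (hAbin : ∀ ω, A ω = 0 ∨ A ω = 1)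
    (hY : Integrable Y μ) (hY0 : Integrable Y0 μ) (hY1 : Integrable Y1 μ)
    -- membership probabilities
    (p : Fin K → 𝒳 → ℝ) (hp : ∀ k, Measurable (p k))
    (hpdef : ∀ k : Fin K,
      μ[(fun ω => if S ω = k then (1 : ℝ) else 0) | MeasurableSpace.comap X inferInstance]
        =ᵐ[μ] fun ω => p k (X ω))
    -- study-specific heterogeneous treatment effects, bounded
    (τk : Fin K → 𝒳 → ℝ) (hτk : ∀ k, Measurable (τk k))
    (hτkbdd : ∀ k : Fin K, ∃ C : ℝ, ∀ x : 𝒳, |τk k x| ≤ C)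
    (hτkdef :
      μ[(fun ω => Y1 ω - Y0 ω) |
          MeasurableSpace.comap (fun ω => (X ω, S ω)) inferInstance]
        =ᵐ[μ] fun ω => ∑ k : Fin K, (if S ω = k then (1 : ℝ) else 0) * τk k (X ω))
    -- study-specific baseline means, bounded
    (μk0 : Fin K → 𝒳 → ℝ) (hμk0 : ∀ k, Measurable (μk0 k))
    (hμk0bdd : ∀ k : Fin K, ∃ C : ℝ, ∀ x : 𝒳, |μk0 k x| ≤ C)
    (hμk0def :
      μ[Y0 | MeasurableSpace.comap (fun ω => (X ω, S ω)) inferInstance]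
        =ᵐ[μ] fun ω => ∑ k : Fin K, (if S ω = k then (1 : ℝ) else 0) * μk0 k (X ω))
    -- Assumption 1 (consistency)
    (hconsistency : ∀ᵐ ω ∂μ, Y ω = A ω * Y1 ω + (1 - A ω) * Y0 ω)
    -- Assumption 2 (mean unconfoundedness within study)
    (hunconf1 :
      μ[(fun ω => A ω * Y1 ω) | MeasurableSpace.comap (fun ω => (X ω, S ω)) inferInstance]
        =ᵐ[μ] fun ω =>
          (μ[A | MeasurableSpace.comap (fun ω => (X ω, S ω)) inferInstance]) ω *
          (μ[Y1 | MeasurableSpace.comap (fun ω => (X ω, S ω)) inferInstance]) ω)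
    (hunconf0 :
      μ[(fun ω => (1 - A ω) * Y0 ω) |
          MeasurableSpace.comap (fun ω => (X ω, S ω)) inferInstance]
        =ᵐ[μ] fun ω =>
          (μ[(fun ω => 1 - A ω) |
              MeasurableSpace.comap (fun ω => (X ω, S ω)) inferInstance]) ω *
          (μ[Y0 | MeasurableSpace.comap (fun ω => (X ω, S ω)) inferInstance]) ω)
    -- study membership carries no information about treatment given covariates
    (hSnoinfo : ∀ k : Fin K,
      μ[(fun ω => if S ω = k then (1 : ℝ) else 0) |
          MeasurableSpace.comap (fun ω => (A ω, X ω)) inferInstance]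
        =ᵐ[μ] fun ω => p k (X ω)) :
    μ[(fun ω => Y ω - ∑ k : Fin K, (μk0 k (X ω) + A ω * τk k (X ω)) * p k (X ω)) |
        MeasurableSpace.comap (fun ω => (A ω, X ω)) inferInstance]
      =ᵐ[μ] fun _ => (0 : ℝ) := by
  have hm : MeasurableSpace.comap (fun ω => (A ω, X ω)) inferInstance ≤ ‹MeasurableSpace Ω› :=
    (hA.prodMk hX).comap_le
  have hn : MeasurableSpace.comap (fun ω => (X ω, S ω)) inferInstance ≤ ‹MeasurableSpace Ω› :=
    (hX.prodMk hS).comap_le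
  -- indicator bookkeeping
  have hsum : ∀ (f : Fin K → 𝒳 → ℝ) ω,
      ∑ k : Fin K, (if S ω = k then (1 : ℝ) else 0) * f k (X ω) = f (S ω) (X ω) := by
    intro f ω
    simp
  have hmeas : ∀ f : Fin K → 𝒳 → ℝ, (∀ k, Measurable (f k)) →
      StronglyMeasurable[MeasurableSpace.comap (fun ω => (X ω, S ω)) inferInstance]
        (fun ω => f (S ω) (X ω)) := by
    intro f hf
    have h1 : Measurable (fun q : 𝒳 × Fin K => f q.2 q.1) :=
      measurable_from_prod_countable_left hf
    exact (h1.comp (comap_measurable (fun ω => (X ω, S ω)))).stronglyMeasurable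
  have hind : ∀ k : Fin K, Integrable (fun ω => if S ω = k then (1 : ℝ) else 0) μ := by
    intro k
    refine Integrable.of_bound (C := 1) ?_ ?_
    · exact (Measurable.ite (hS (measurableSet_singleton k)) measurable_const
        measurable_const).aestronglyMeasurable
    · refine Filter.Eventually.of_forall fun ω => ?_
      split_ifs <;> simp
  have hA1 : ∀ ω, ‖A ω‖ ≤ 1 := by
    intro ω
    rcases hAbin ω with h | h <;> simp [h]
  have hA1' : ∀ ω, ‖1 - A ω‖ ≤ 1 := by
    intro ω
    rcases hAbin ω with h | h <;> simp [h]
  have hAm : Measurable (fun ω => 1 - A ω) := measurable_const.sub hA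
  have hAi : Integrable A μ :=
    Integrable.of_bound (C := 1) hA.aestronglyMeasurable (Filter.Eventually.of_forall hA1)
  have hAi' : Integrable (fun ω => 1 - A ω) μ :=
    Integrable.of_bound (C := 1) hAm.aestronglyMeasurable (Filter.Eventually.of_forall hA1')
  have hAmul : ∀ Z : Ω → ℝ, Integrable Z μ → Integrable (fun ω => A ω * Z ω) μ :=
    fun Z hZ => hZ.bdd_mul hA.aestronglyMeasurable (Filter.Eventually.of_forall hA1)
  have hAmul' : ∀ Z : Ω → ℝ, Integrable Z μ → Integrable (fun ω => (1 - A ω) * Z ω) μ :=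
    fun Z hZ => hZ.bdd_mul hAm.aestronglyMeasurable (Filter.Eventually.of_forall hA1')
  have hM0ae : μ[Y0 | MeasurableSpace.comap (fun ω => (X ω, S ω)) inferInstance]
      =ᵐ[μ] fun ω => μk0 (S ω) (X ω) := by
    simpa only [hsum] using hμk0def
  have hTae : μ[(fun ω => Y1 ω - Y0 ω) |
        MeasurableSpace.comap (fun ω => (X ω, S ω)) inferInstance]
      =ᵐ[μ] fun ω => τk (S ω) (X ω) := by
    simpa only [hsum] using hτkdef
  have hM1ae : μ[Y1 | MeasurableSpace.comap (fun ω => (X ω, S ω)) inferInstance]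
      =ᵐ[μ] fun ω => μk0 (S ω) (X ω) + τk (S ω) (X ω) := by
    have h := condExp_sub hY1 hY0
      (MeasurableSpace.comap (fun ω => (X ω, S ω)) inferInstance)
    filter_upwards [h, hTae, hM0ae] with ω a b c
    have a' : (μ[(fun ω => Y1 ω - Y0 ω) |
        MeasurableSpace.comap (fun ω => (X ω, S ω)) inferInstance]) ω = _ := a
    rw [b, Pi.sub_apply, c] at a'
    linarith
  have hM0i : Integrable (fun ω => μk0 (S ω) (X ω)) μ := integrable_condExp.congr hM0ae
  have hM1i : Integrable (fun ω => μk0 (S ω) (X ω) + τk (S ω) (X ω)) μ :=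
    integrable_condExp.congr hM1ae
  have hU1i : Integrable (fun ω => A ω * (Y1 ω - (μk0 (S ω) (X ω) + τk (S ω) (X ω)))) μ :=
    hAmul _ (hY1.sub hM1i)
  have hU0i : Integrable (fun ω => (1 - A ω) * (Y0 ω - μk0 (S ω) (X ω))) μ :=
    hAmul' _ (hY0.sub hM0i)
  have hU1 := condExp_AX_zero_of_support μ X S A _ 1 hX hS hA hU1i
    (fun ω h => by simp [(hAbin ω).resolve_right h])
    (condExp_weighted_residual_zero μ _ A Y1 _ ((hmeas _ hμk0).add (hmeas _ hτk)) hAi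
      (hAmul _ hY1) (hAmul _ hM1i) hM1ae hunconf1)
  have hU0 := condExp_AX_zero_of_support μ X S A _ 0 hX hS hA hU0i
    (fun ω h => by simp [(hAbin ω).resolve_left h])
    (condExp_weighted_residual_zero μ _ (fun ω => 1 - A ω) Y0 _ (hmeas _ hμk0) hAi'
      (hAmul' _ hY0) (hAmul' _ hM0i) hM0ae hunconf0)
  -- the membership residuals
  have hpi : ∀ k, Integrable (fun ω => p k (X ω)) μ :=
    fun k => integrable_condExp.congr (hSnoinfo k)
  have hDi : ∀ k, Integrable
      ((fun ω => if S ω = k then (1 : ℝ) else 0) - (fun ω => p k (X ω))) μ :=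
    fun k => (hind k).sub (hpi k)
  have hAX : Measurable[MeasurableSpace.comap (fun ω => (A ω, X ω)) inferInstance]
      (fun ω => (A ω, X ω)) := comap_measurable _
  have hgm : ∀ k, StronglyMeasurable[MeasurableSpace.comap (fun ω => (A ω, X ω)) inferInstance]
      (fun ω => μk0 k (X ω) + A ω * τk k (X ω)) := by
    intro k
    have h1 : Measurable (fun q : ℝ × 𝒳 => μk0 k q.2 + q.1 * τk k q.2) :=
      ((hμk0 k).comp measurable_snd).add (measurable_fst.mul ((hτk k).comp measurable_snd))
    exact (h1.comp hAX).stronglyMeasurable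
  have hVi : ∀ k, Integrable ((fun ω => μk0 k (X ω) + A ω * τk k (X ω)) *
      ((fun ω => if S ω = k then (1 : ℝ) else 0) - (fun ω => p k (X ω)))) μ := by
    intro k
    obtain ⟨C, hC⟩ := hμk0bdd k
    obtain ⟨D, hD⟩ := hτkbdd k
    refine (hDi k).bdd_mul (c := C + D) ((hgm k).mono hm).aestronglyMeasurable
      (Filter.Eventually.of_forall fun ω => ?_)
    refine (norm_add_le _ _).trans (add_le_add (hC _) ?_)
    rw [norm_mul]
    calc ‖A ω‖ * ‖τk k (X ω)‖ ≤ 1 * ‖τk k (X ω)‖ :=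
          mul_le_mul_of_nonneg_right (hA1 ω) (norm_nonneg _)
      _ ≤ D := by rw [one_mul]; exact hD _
  have hV : ∀ k, μ[(fun ω => μk0 k (X ω) + A ω * τk k (X ω)) *
      ((fun ω => if S ω = k then (1 : ℝ) else 0) - (fun ω => p k (X ω))) |
      MeasurableSpace.comap (fun ω => (A ω, X ω)) inferInstance] =ᵐ[μ] 0 := by
    intro k
    have h1 := condExp_mul_of_stronglyMeasurable_left (hgm k) (hVi k) (hDi k)
    have h2 := condExp_sub (hind k) (hpi k)
      (MeasurableSpace.comap (fun ω => (A ω, X ω)) inferInstance)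
    have h3 : μ[(fun ω => p k (X ω)) |
        MeasurableSpace.comap (fun ω => (A ω, X ω)) inferInstance] = fun ω => p k (X ω) :=
      condExp_of_stronglyMeasurable hm
        (((hp k).comp (measurable_snd.comp hAX)).stronglyMeasurable) (hpi k)
    filter_upwards [h1, h2, hSnoinfo k] with ω a b c
    rw [a, Pi.mul_apply, b, Pi.sub_apply, c, h3]
    simp
  -- decomposition
  have hdec : (fun ω => Y ω - ∑ k : Fin K, (μk0 k (X ω) + A ω * τk k (X ω)) * p k (X ω))
      =ᵐ[μ] ((fun ω => A ω * (Y1 ω - (μk0 (S ω) (X ω) + τk (S ω) (X ω))))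
        + (fun ω => (1 - A ω) * (Y0 ω - μk0 (S ω) (X ω))))
        + ∑ k : Fin K, (fun ω => μk0 k (X ω) + A ω * τk k (X ω)) *
          ((fun ω => if S ω = k then (1 : ℝ) else 0) - (fun ω => p k (X ω))) := by
    filter_upwards [hconsistency] with ω h
    simp only [Pi.add_apply, Finset.sum_apply, Pi.mul_apply, Pi.sub_apply, mul_sub,
      Finset.sum_sub_distrib, mul_ite, mul_one, mul_zero, Finset.sum_ite_eq, Finset.mem_univ,
      if_true]
    rw [h]
    ring
  refine (condExp_congr_ae hdec).trans ?_
  have hs1 := condExp_add (hU1i.add hU0i) (integrable_finsetSum' Finset.univ fun k _ => hVi k)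
    (MeasurableSpace.comap (fun ω => (A ω, X ω)) inferInstance)
  have hs2 := condExp_add hU1i hU0i
    (MeasurableSpace.comap (fun ω => (A ω, X ω)) inferInstance)
  have hs3 := condExp_finsetSum (s := Finset.univ) (fun k _ => hVi k)
    (MeasurableSpace.comap (fun ω => (A ω, X ω)) inferInstance)
  filter_upwards [hs1, hs2, hs3, hU1, hU0, ae_all_iff.2 hV] with ω a b c d e f
  rw [a, Pi.add_apply, b, Pi.add_apply, c, d, e, Finset.sum_apply,
    Finset.sum_congr rfl (fun k _ => f k)]
  simp
end

section
/- (Multi-study Robinson's transformation, Equation (2).) Define the error term ε := Y − Σ_{k=1}^K { μ_k^{(0)}(X) + A·τ_k(X) } · p(k|X). Under Assumption 1 (consistency) and Assumption 2 (mean unconfoundedness within study), with Y, Y(0), Y(1) integrable and μ_k^{(0)}, τ_k, e_k bounded, the following identity holds almost surely: Y − m(X) = Σ_{k=1}^K (A − e_k(X)) · p(k|X) · τ_k(X) + ε. -/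
open MeasureTheory

/-- Multi-study Robinson's transformation, Equation (2). Define
`ε := Y − ∑_{k=1}^K { μ_k^{(0)}(X) + A·τ_k(X) } · p(k|X)`. Under consistency and mean
unconfoundedness within study, with `Y, Y(0), Y(1)` integrable and `μ_k^{(0)}, τ_k, e_k`
bounded, almost surely
`Y − m(X) = ∑_{k=1}^K (A − e_k(X)) · p(k|X) · τ_k(X) + ε`. -/
theorem multi_study_robinson_transformation
    {Ω : Type*} [MeasurableSpace Ω] (μ : Measure Ω) [IsProbabilityMeasure μ]
    {𝒳 : Type*} [MeasurableSpace 𝒳]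
    (K : ℕ) (X : Ω → 𝒳) (S : Ω → Fin K) (A : Ω → ℝ) (Y Y0 Y1 : Ω → ℝ)
    (hX : Measurable X) (hS : Measurable S) (hA : Measurable A)
    (hAbin : ∀ ω, A ω = 0 ∨ A ω = 1)
    (hY : Integrable Y μ) (hY0 : Integrable Y0 μ) (hY1 : Integrable Y1 μ)
    -- membership probabilities
    (p : Fin K → 𝒳 → ℝ) (hp : ∀ k, Measurable (p k))
    (hpdef : ∀ k : Fin K,
      μ[(fun ω => if S ω = k then (1 : ℝ) else 0) | MeasurableSpace.comap X inferInstance]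
        =ᵐ[μ] fun ω => p k (X ω))
    -- study-specific heterogeneous treatment effects, bounded
    (τk : Fin K → 𝒳 → ℝ) (hτk : ∀ k, Measurable (τk k))
    (hτkbdd : ∀ k : Fin K, ∃ C : ℝ, ∀ x : 𝒳, |τk k x| ≤ C)
    (hτkdef :
      μ[(fun ω => Y1 ω - Y0 ω) |
          MeasurableSpace.comap (fun ω => (X ω, S ω)) inferInstance]
        =ᵐ[μ] fun ω => ∑ k : Fin K, (if S ω = k then (1 : ℝ) else 0) * τk k (X ω))
    -- study-specific baseline means, bounded
    (μk0 : Fin K → 𝒳 → ℝ) (hμk0 : ∀ k, Measurable (μk0 k))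
    (hμk0bdd : ∀ k : Fin K, ∃ C : ℝ, ∀ x : 𝒳, |μk0 k x| ≤ C)
    (hμk0def :
      μ[Y0 | MeasurableSpace.comap (fun ω => (X ω, S ω)) inferInstance]
        =ᵐ[μ] fun ω => ∑ k : Fin K, (if S ω = k then (1 : ℝ) else 0) * μk0 k (X ω))
    -- study-specific propensity functions, bounded
    (e : Fin K → 𝒳 → ℝ) (he : ∀ k, Measurable (e k))
    (hebdd : ∀ k : Fin K, ∃ C : ℝ, ∀ x : 𝒳, |e k x| ≤ C)
    (hedef :
      μ[A | MeasurableSpace.comap (fun ω => (X ω, S ω)) inferInstance]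
        =ᵐ[μ] fun ω => ∑ k : Fin K, (if S ω = k then (1 : ℝ) else 0) * e k (X ω))
    -- conditional mean outcome
    (m : 𝒳 → ℝ) (hm : Measurable m)
    (hmdef : μ[Y | MeasurableSpace.comap X inferInstance] =ᵐ[μ] fun ω => m (X ω))
    -- Assumption 1 (consistency)
    (hconsistency : ∀ᵐ ω ∂μ, Y ω = A ω * Y1 ω + (1 - A ω) * Y0 ω)
    -- Assumption 2 (mean unconfoundedness within study)
    (hunconf1 :
      μ[(fun ω => A ω * Y1 ω) | MeasurableSpace.comap (fun ω => (X ω, S ω)) inferInstance]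
        =ᵐ[μ] fun ω =>
          (μ[A | MeasurableSpace.comap (fun ω => (X ω, S ω)) inferInstance]) ω *
          (μ[Y1 | MeasurableSpace.comap (fun ω => (X ω, S ω)) inferInstance]) ω)
    (hunconf0 :
      μ[(fun ω => (1 - A ω) * Y0 ω) |
          MeasurableSpace.comap (fun ω => (X ω, S ω)) inferInstance]
        =ᵐ[μ] fun ω =>
          (μ[(fun ω => 1 - A ω) |
              MeasurableSpace.comap (fun ω => (X ω, S ω)) inferInstance]) ω *
          (μ[Y0 | MeasurableSpace.comap (fun ω => (X ω, S ω)) inferInstance]) ω) :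
    ∀ᵐ ω ∂μ,
      Y ω - m (X ω) =
        (∑ k : Fin K, (A ω - e k (X ω)) * p k (X ω) * τk k (X ω)) +
          (Y ω - ∑ k : Fin K, (μk0 k (X ω) + A ω * τk k (X ω)) * p k (X ω)) := by
  classical
  have hle1 : MeasurableSpace.comap (fun ω => (X ω, S ω)) inferInstance ≤ ‹MeasurableSpace Ω› :=
    (hX.prodMk hS).comap_le
  have hle0 : MeasurableSpace.comap X inferInstance ≤
      MeasurableSpace.comap (fun ω => (X ω, S ω)) inferInstance := by
    rintro s ⟨t, ht, rfl⟩
    exact ⟨Prod.fst ⁻¹' t, measurable_fst ht, rfl⟩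
  have hAb : ∀ ω, ‖A ω‖ ≤ 1 := by
    intro ω
    rcases hAbin ω with h | h <;> simp [h]
  have hAb' : ∀ ω, ‖1 - A ω‖ ≤ 1 := by
    intro ω
    rcases hAbin ω with h | h <;> simp [h]
  have hAint : Integrable A μ :=
    Integrable.of_bound hA.aestronglyMeasurable 1 (Filter.Eventually.of_forall hAb)
  have hAY1 : Integrable (fun ω => A ω * Y1 ω) μ :=
    hY1.bdd_mul hA.aestronglyMeasurable (Filter.Eventually.of_forall hAb)
  have hAY0 : Integrable (fun ω => (1 - A ω) * Y0 ω) μ :=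
    hY0.bdd_mul (hA.const_sub 1).aestronglyMeasurable (Filter.Eventually.of_forall hAb')
  let g : Fin K → 𝒳 → ℝ := fun k x => μk0 k x + e k x * τk k x
  have hg : ∀ k, Measurable (g k) := fun k => (hμk0 k).add ((he k).mul (hτk k))
  have hgb : ∀ k, ∃ C : ℝ, ∀ x, ‖g k x‖ ≤ C := by
    intro k
    obtain ⟨a, ha⟩ := hμk0bdd k
    obtain ⟨b, hb⟩ := hebdd k
    obtain ⟨c, hc⟩ := hτkbdd k
    refine ⟨a + b * c, fun x => (norm_add_le _ _).trans (add_le_add (ha x) ?_)⟩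
    rw [norm_mul]
    exact mul_le_mul (hb x) (hc x) (norm_nonneg _) ((abs_nonneg _).trans (hb x))
  let I : Fin K → Ω → ℝ := fun k ω => if S ω = k then (1 : ℝ) else 0
  have hI : ∀ k, Measurable (I k) := fun k =>
    Measurable.ite (hS (measurableSet_singleton k)) measurable_const measurable_const
  have hIint : ∀ k, Integrable (I k) μ := fun k =>
    Integrable.of_bound (hI k).aestronglyMeasurable 1 (Filter.Eventually.of_forall fun ω => by
      by_cases h : S ω = k <;> simp [I, h])
  have hgI : ∀ k, Integrable ((fun ω => g k (X ω)) * I k) μ := by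
    intro k
    obtain ⟨C, hC⟩ := hgb k
    exact (hIint k).bdd_mul ((hg k).comp hX).aestronglyMeasurable
      (Filter.Eventually.of_forall fun ω => hC (X ω))
  -- the conditional mean given (X, S)
  have h1 : μ[Y | MeasurableSpace.comap (fun ω => (X ω, S ω)) inferInstance]
      =ᵐ[μ] ∑ k : Fin K, (fun ω => g k (X ω)) * I k := by
    have a1 : μ[Y | MeasurableSpace.comap (fun ω => (X ω, S ω)) inferInstance] =ᵐ[μ]
        μ[(fun ω => A ω * Y1 ω) + (fun ω => (1 - A ω) * Y0 ω) |
          MeasurableSpace.comap (fun ω => (X ω, S ω)) inferInstance] :=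
      condExp_congr_ae hconsistency
    have a2 := condExp_add hAY1 hAY0
      (MeasurableSpace.comap (fun ω => (X ω, S ω)) inferInstance)
    have a3 : μ[(fun ω => 1 - A ω) | MeasurableSpace.comap (fun ω => (X ω, S ω)) inferInstance]
        =ᵐ[μ] _ := condExp_sub (integrable_const (1 : ℝ)) hAint
      (MeasurableSpace.comap (fun ω => (X ω, S ω)) inferInstance)
    rw [condExp_const hle1] at a3
    have a4 : μ[(fun ω => Y1 ω - Y0 ω) |
        MeasurableSpace.comap (fun ω => (X ω, S ω)) inferInstance]
        =ᵐ[μ] _ := condExp_sub hY1 hY0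
      (MeasurableSpace.comap (fun ω => (X ω, S ω)) inferInstance)
    filter_upwards [a1, a2, a3, a4, hτkdef, hμk0def, hedef, hunconf1, hunconf0]
      with ω b1 b2 b3 b4 b5 b6 b7 b8 b9
    rw [b1, b2]
    simp only [Pi.add_apply, Pi.sub_apply] at b3 b4 ⊢
    rw [b8, b9, b3]
    rw [b4] at b5
    simp only [Finset.sum_apply, Pi.mul_apply, I, g]
    simp only [ite_mul, mul_ite, one_mul, mul_one, zero_mul, mul_zero, Finset.sum_ite_eq,
      Finset.mem_univ, if_true] at b5 b6 b7 ⊢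
    rw [← b5, ← b6, ← b7]
    ring
  have h2 := condExp_condExp_of_le (f := Y) (μ := μ) hle0 hle1
  have h3 := condExp_congr_ae (m := MeasurableSpace.comap X inferInstance) h1
  have h4 := condExp_finsetSum (μ := μ) (s := Finset.univ) (fun k _ => hgI k)
    (MeasurableSpace.comap X inferInstance)
  have h5 : ∀ k, μ[(fun ω => g k (X ω)) * I k | MeasurableSpace.comap X inferInstance]
      =ᵐ[μ] (fun ω => g k (X ω)) * μ[I k | MeasurableSpace.comap X inferInstance] := by
    intro k
    refine condExp_mul_of_stronglyMeasurable_left ?_ (hgI k) (hIint k)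
    exact ((hg k).comp (comap_measurable X)).stronglyMeasurable
  have h6 : ∀ᵐ ω ∂μ, ∀ k, (μ[(fun ω => g k (X ω)) * I k |
      MeasurableSpace.comap X inferInstance]) ω = g k (X ω) * p k (X ω) := by
    rw [ae_all_iff]
    intro k
    filter_upwards [h5 k, hpdef k] with ω c1 c2
    rw [c1, Pi.mul_apply, c2]
  filter_upwards [h2, h3, h4, h6, hmdef] with ω d2 d3 d4 d6 d7
  have key : m (X ω) = ∑ k, g k (X ω) * p k (X ω) := by
    rw [← d7, ← d2, d3, d4, Finset.sum_apply]
    exact Finset.sum_congr rfl fun k _ => d6 k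
  rw [key, add_sub_left_comm, sub_eq_add_neg (Y ω), ← Finset.sum_sub_distrib,
    ← Finset.sum_neg_distrib]
  congr 1
  refine Finset.sum_congr rfl fun k _ => ?_
  simp only [g]
  ring
end

section
/- (Reduction to the single-study Robinson transformation.) Let e* be a measurable function with E[A | σ(X)] = e*(X) a.s., and let τ be a measurable function with E[Y(1)−Y(0) | σ(X)] = τ(X) a.s. Assume τ_k and e_k are bounded and Y(1)−Y(0) is integrable. (i) If there is a single propensity function e with e_k = e for all k = 1,…,K, then almost surely Σ_{k=1}^K (A − e_k(X)) p(k|X) τ_k(X) = (A − e(X)) τ(X). (ii) If there is a single treatment-effect function τ with τ_k = τ for all k = 1,…,K, then almost surely Σ_{k=1}^K (A − e_k(X)) p(k|X) τ_k(X) = (A − e*(X)) τ(X), where moreover e*(X) = Σ_{k=1}^K e_k(X) p(k|X) a.s. In either case the multi-study Robinson transformation reduces to the single-study form (A − e(X)) τ(X). -/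
open MeasureTheory

/-- Tower property plus pull-out: averaging the study-specific regressions. -/
theorem condExp_eq_sum_mul_membership
    {Ω : Type*} [MeasurableSpace Ω] (μ : Measure Ω) [IsProbabilityMeasure μ]
    {𝒳 : Type*} [MeasurableSpace 𝒳]
    (K : ℕ) (X : Ω → 𝒳) (S : Ω → Fin K)
    (hX : Measurable X) (hS : Measurable S)
    (p : Fin K → 𝒳 → ℝ)
    (hpdef : ∀ k : Fin K,
      μ[(fun ω => if S ω = k then (1 : ℝ) else 0) | MeasurableSpace.comap X inferInstance]
        =ᵐ[μ] fun ω => p k (X ω))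
    (D : Ω → ℝ) (f : Fin K → 𝒳 → ℝ) (hf : ∀ k, Measurable (f k))
    (hfb : ∀ k : Fin K, ∃ C : ℝ, ∀ x : 𝒳, |f k x| ≤ C)
    (hfdef :
      μ[D | MeasurableSpace.comap (fun ω => (X ω, S ω)) inferInstance]
        =ᵐ[μ] fun ω => ∑ k : Fin K, (if S ω = k then (1 : ℝ) else 0) * f k (X ω)) :
    μ[D | MeasurableSpace.comap X inferInstance]
      =ᵐ[μ] fun ω => ∑ k : Fin K, f k (X ω) * p k (X ω) := by
  have hle : MeasurableSpace.comap X inferInstance ≤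
      MeasurableSpace.comap (fun ω => (X ω, S ω)) inferInstance := by
    rintro _ ⟨s, hs, rfl⟩
    exact ⟨Prod.fst ⁻¹' s, measurable_fst hs, rfl⟩
  have hle2 := (hX.prodMk hS).comap_le
  have h1 := condExp_condExp_of_le (μ := μ) (f := D) hle hle2
  have hind : ∀ k, Measurable (fun ω => if S ω = k then (1 : ℝ) else 0) := fun k =>
    Measurable.ite (hS (measurableSet_singleton k)) measurable_const measurable_const
  have hI : ∀ k, Integrable (fun ω => if S ω = k then (1 : ℝ) else 0) μ := fun k => by
    refine Integrable.of_bound (hind k).aestronglyMeasurable 1 (ae_of_all _ fun ω => ?_)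
    split_ifs <;> simp
  have hFI : ∀ k, Integrable
      ((fun ω => f k (X ω)) * (fun ω => if S ω = k then (1 : ℝ) else 0)) μ := fun k => by
    obtain ⟨C, hC⟩ := hfb k
    exact (hI k).bdd_mul ((hf k).comp hX).aestronglyMeasurable
      (ae_of_all _ fun ω => by simpa using hC (X ω))
  have h2 : (fun ω => ∑ k : Fin K, (if S ω = k then (1 : ℝ) else 0) * f k (X ω))
      = ∑ k : Fin K, ((fun ω => f k (X ω)) * (fun ω => if S ω = k then (1 : ℝ) else 0)) := by
    funext ω
    rw [Finset.sum_apply]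
    exact Finset.sum_congr rfl fun k _ => mul_comm _ _
  have h3 := condExp_congr_ae (m := MeasurableSpace.comap X inferInstance) hfdef
  rw [h2] at h3
  have h4 := condExp_finsetSum (s := Finset.univ) (fun k _ => hFI k)
    (MeasurableSpace.comap X inferInstance)
  have h5 : ∀ k, μ[(fun ω => f k (X ω)) * (fun ω => if S ω = k then (1 : ℝ) else 0) |
      MeasurableSpace.comap X inferInstance] =ᵐ[μ] _ := fun k =>
    condExp_mul_of_stronglyMeasurable_left
      (((hf k).comp (comap_measurable X)).stronglyMeasurable) (hFI k) (hI k)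
  filter_upwards [h1, h3, h4, ae_all_iff.2 h5, ae_all_iff.2 hpdef] with ω a1 a3 a4 a5 a6
  rw [← a1, a3, a4, Finset.sum_apply]
  refine Finset.sum_congr rfl fun k _ => ?_
  rw [a5 k, Pi.mul_apply, a6 k]

/-- Reduction to the single-study Robinson transformation.
(i) If `e_k = e` for all `k`, then a.s.
`∑_k (A − e_k(X)) p(k|X) τ_k(X) = (A − e(X)) τ(X)`.
(ii) If `τ_k = τ` for all `k`, then a.s.
`∑_k (A − e_k(X)) p(k|X) τ_k(X) = (A − e*(X)) τ(X)`, where moreover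
`e*(X) = ∑_k e_k(X) p(k|X)` a.s. -/
theorem multi_study_robinson_reduces_to_single_study
    {Ω : Type*} [MeasurableSpace Ω] (μ : Measure Ω) [IsProbabilityMeasure μ]
    {𝒳 : Type*} [MeasurableSpace 𝒳]
    (K : ℕ) (X : Ω → 𝒳) (S : Ω → Fin K) (A : Ω → ℝ) (Y0 Y1 : Ω → ℝ)
    (hX : Measurable X) (hS : Measurable S) (hA : Measurable A)
    (hAbin : ∀ ω, A ω = 0 ∨ A ω = 1)
    (hD : Integrable (fun ω => Y1 ω - Y0 ω) μ)
    -- membership probabilities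
    (p : Fin K → 𝒳 → ℝ) (hp : ∀ k, Measurable (p k))
    (hpdef : ∀ k : Fin K,
      μ[(fun ω => if S ω = k then (1 : ℝ) else 0) | MeasurableSpace.comap X inferInstance]
        =ᵐ[μ] fun ω => p k (X ω))
    -- study-specific heterogeneous treatment effects, bounded
    (τk : Fin K → 𝒳 → ℝ) (hτk : ∀ k, Measurable (τk k))
    (hτkbdd : ∀ k : Fin K, ∃ C : ℝ, ∀ x : 𝒳, |τk k x| ≤ C)
    (hτkdef :
      μ[(fun ω => Y1 ω - Y0 ω) |
          MeasurableSpace.comap (fun ω => (X ω, S ω)) inferInstance]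
        =ᵐ[μ] fun ω => ∑ k : Fin K, (if S ω = k then (1 : ℝ) else 0) * τk k (X ω))
    -- study-specific propensity functions, bounded
    (e : Fin K → 𝒳 → ℝ) (he : ∀ k, Measurable (e k))
    (hebdd : ∀ k : Fin K, ∃ C : ℝ, ∀ x : 𝒳, |e k x| ≤ C)
    (hedef :
      μ[A | MeasurableSpace.comap (fun ω => (X ω, S ω)) inferInstance]
        =ᵐ[μ] fun ω => ∑ k : Fin K, (if S ω = k then (1 : ℝ) else 0) * e k (X ω))
    -- overall propensity e* and overall heterogeneous treatment effect τ
    (estar : 𝒳 → ℝ) (hestar : Measurable estar)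
    (hestardef : μ[A | MeasurableSpace.comap X inferInstance]
        =ᵐ[μ] fun ω => estar (X ω))
    (τ : 𝒳 → ℝ) (hτ : Measurable τ)
    (hτdef : μ[(fun ω => Y1 ω - Y0 ω) | MeasurableSpace.comap X inferInstance]
        =ᵐ[μ] fun ω => τ (X ω)) :
    -- (i) a single propensity function across studies
    (∀ esingle : 𝒳 → ℝ, (∀ k : Fin K, e k = esingle) →
      ∀ᵐ ω ∂μ,
        ∑ k : Fin K, (A ω - e k (X ω)) * p k (X ω) * τk k (X ω) =
          (A ω - esingle (X ω)) * τ (X ω)) ∧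
    -- (ii) a single treatment-effect function across studies
    ((∀ k : Fin K, τk k = τ) →
      (∀ᵐ ω ∂μ,
        ∑ k : Fin K, (A ω - e k (X ω)) * p k (X ω) * τk k (X ω) =
          (A ω - estar (X ω)) * τ (X ω)) ∧
      (∀ᵐ ω ∂μ, estar (X ω) = ∑ k : Fin K, e k (X ω) * p k (X ω))) := by
  have L := condExp_eq_sum_mul_membership μ K X S hX hS p hpdef
  have hT := L _ τk hτk hτkbdd hτkdef
  have hE := L _ e he hebdd hedef
  have h1 := L (fun _ => 1) (fun _ _ => 1) (fun _ => measurable_const)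
    (fun _ => ⟨1, fun _ => by simp⟩) (by
      rw [condExp_const (hX.prodMk hS).comap_le]
      exact ae_of_all _ fun ω => by simp)
  rw [condExp_const hX.comap_le] at h1
  refine ⟨fun es hes => ?_, fun hs => ⟨?_, ?_⟩⟩
  · filter_upwards [hT, hτdef] with ω a b
    rw [← b, a, Finset.mul_sum]
    refine Finset.sum_congr rfl fun k _ => ?_
    rw [hes k]; ring
  · filter_upwards [hE, hestardef, h1] with ω a b c
    have c' : ∑ k : Fin K, p k (X ω) = 1 := by simpa using c.symm
    rw [← b, a]
    calc _ = ∑ k : Fin K, (A ω * p k (X ω) - e k (X ω) * p k (X ω)) * τ (X ω) :=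
          Finset.sum_congr rfl fun k _ => by rw [hs k]; ring
      _ = _ := by rw [← Finset.sum_mul, Finset.sum_sub_distrib, ← Finset.mul_sum, c', mul_one]
  · filter_upwards [hE, hestardef] with ω a b
    rw [← b, a]
end
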